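/- Let q be a nondegenerate quadratic form of rank n ≥ 5 over a field k of characteristic ≠ 2. Then the Brauer kernel κ(k(q)/k) is trivial: every central simple k-algebra split by the function field of the quadric hypersurface q = 0 is already split over k. -/

import Mathlib

open scoped TensorProduct
open Quaternion
set_option synthInstance.maxHeartbeats 1000000
set_option maxHeartbeats 1000000
noncomputable section

universe u v

/-- Upper-triangular coefficient matrix of a quadratic form on `Fin n → R`. -/
def coeffMatrix {R : Type*} [CommRing R] {n : ℕ} (q : QuadraticForm R (Fin n → R)) :
    Matrix (Fin n) (Fin n) R :=
  Matrix.of fun i j =>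
    if i = j then q (Pi.single i 1)
    else if i < j then QuadraticMap.polar q (Pi.single i 1) (Pi.single j 1)
    else 0

/-- Base change of a quadratic form on `Fin n → R` along `R → l`. -/
def extendQF {R : Type*} [CommRing R] {n : ℕ} (q : QuadraticForm R (Fin n → R))
    (l : Type*) [CommRing l] [Algebra R l] : QuadraticForm l (Fin n → l) :=
  ((coeffMatrix q).map (algebraMap R l)).toQuadraticMap'

/-- Gram matrix of the polar bilinear form of `q`. -/
def polarMatrix {R : Type*} [CommRing R] {n : ℕ} (q : QuadraticForm R (Fin n → R)) :
    Matrix (Fin n) (Fin n) R :=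
  Matrix.of fun i j => QuadraticMap.polar q (Pi.single i 1) (Pi.single j 1)

/-- Discriminant: determinant of the Gram matrix (well defined up to squares). -/
def discQF {R : Type*} [CommRing R] {n : ℕ} (q : QuadraticForm R (Fin n → R)) : R :=
  (polarMatrix q).det

/-- Nondegeneracy (char ≠ 2): the Gram determinant is nonzero. -/
def NondegQF {R : Type*} [CommRing R] {n : ℕ} (q : QuadraticForm R (Fin n → R)) : Prop :=
  discQF q ≠ 0

/-- Two quadratic forms are similar if one is isometric to a unit scaling of the other. -/
def SimilarQF {R : Type*} [CommRing R] {n : ℕ} (q q' : QuadraticForm R (Fin n → R)) : Prop :=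
  ∃ c : R, IsUnit c ∧ QuadraticMap.Equivalent (c • q) q'

/-- The polynomial `q(X₁, …, X_{n-1}, 1)` defining the affine quadric. -/
def affineQuadricPoly {R : Type*} [CommRing R] {n : ℕ} (q : QuadraticForm R (Fin n → R)) :
    MvPolynomial (Fin (n - 1)) R :=
  (extendQF q (MvPolynomial (Fin (n - 1)) R))
    (fun i => if h : (i : ℕ) < n - 1 then MvPolynomial.X ⟨i, h⟩ else 1)

/-- Affine coordinate ring `R[x₁,…,x_{n-1}]/(q(x₁,…,x_{n-1},1))` of the quadric. -/
abbrev quadricCoordRing {R : Type*} [CommRing R] {n : ℕ}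
    (q : QuadraticForm R (Fin n → R)) : Type _ :=
  MvPolynomial (Fin (n - 1)) R ⧸ Ideal.span {affineQuadricPoly q}

/-- Function field `k(q)` of the quadric hypersurface `q = 0`. -/
abbrev quadricFunctionField {R : Type*} [CommRing R] {n : ℕ}
    (q : QuadraticForm R (Fin n → R)) : Type _ :=
  FractionRing (quadricCoordRing q)

/-- Affine coordinate ring `k[x,y]/(ax²+by²-1)` of the conic `C_{a,b}`. -/
abbrev conicCoordRing (k : Type*) [Field k] (a b : k) : Type _ :=
  MvPolynomial (Fin 2) k ⧸
    Ideal.span {(MvPolynomial.C a * MvPolynomial.X 0 ^ 2 +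
      MvPolynomial.C b * MvPolynomial.X 1 ^ 2 - 1 : MvPolynomial (Fin 2) k)}

/-- The conic function field `k(C_{a,b})`. -/
abbrev conicFunctionField (k : Type*) [Field k] (a b : k) : Type _ :=
  FractionRing (conicCoordRing k a b)

/-- A `k`-algebra is split if it is isomorphic to a matrix algebra over `k`. -/
def IsSplitAlg (k A : Type*) [Field k] [Ring A] [Algebra k A] : Prop :=
  ∃ n : ℕ, 0 < n ∧ Nonempty (A ≃ₐ[k] Matrix (Fin n) (Fin n) k)

/-- `A` is split by the extension `K/k`: the class of `A` lies in the Brauer kernel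
`κ(K/k) = ker (Br k → Br K)`. -/
def SplitsIn (k : Type*) [Field k] (A : Type*) [Ring A] [Algebra k A]
    (K : Type*) [CommRing K] [Algebra k K] : Prop :=
  ∃ n : ℕ, 0 < n ∧ Nonempty ((K ⊗[k] A) ≃ₐ[K] Matrix (Fin n) (Fin n) K)

/-- Brauer equivalence of two `k`-algebras. -/
def BrauerEquiv (k A B : Type*) [Field k] [Ring A] [Algebra k A] [Ring B] [Algebra k B] :
    Prop :=
  ∃ n m : ℕ, 0 < n ∧ 0 < m ∧
    Nonempty (Matrix (Fin n) (Fin n) A ≃ₐ[k] Matrix (Fin m) (Fin m) B)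

/-- A field is finitely generated (over its prime subfield). -/
def FieldFG (K : Type*) [Field K] : Prop :=
  ∃ s : Finset K, Subfield.closure (s : Set K) = ⊤

/-- Elementary equivalence in the first-order language of rings. -/
def ElemEquivRing (K₁ : Type*) (K₂ : Type*) [CommRing K₁] [CommRing K₂] : Prop :=
  letI := FirstOrder.Ring.compatibleRingOfRing K₁
  letI := FirstOrder.Ring.compatibleRingOfRing K₂
  FirstOrder.Language.ring.ElementarilyEquivalent K₁ K₂

/-- The `m`-fold Pfister form `⟨⟨a₁,…,aₘ⟩⟩ = ⟨1,a₁⟩ ⊗ ⋯ ⊗ ⟨1,aₘ⟩`. -/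
def pfisterForm {k : Type*} [Field k] {m : ℕ} (a : Fin m → k) :
    QuadraticForm k (Fin (2 ^ m) → k) :=
  QuadraticMap.weightedSumSquares k
    (fun j : Fin (2 ^ m) => ∏ i : Fin m, if Nat.testBit (j : ℕ) (i : ℕ) then a i else 1)

/-- A family of pairwise anticommuting elements whose squares are nonzero scalars. -/
def IsAnticommFamily (k : Type*) {E ι : Type*} [Field k] [Ring E] [Algebra k E] (u : ι → E) :
    Prop :=
  (∀ i j, i ≠ j → u i * u j = -(u j * u i)) ∧ ∀ i, ∃ c : k, c ≠ 0 ∧ u i * u i = algebraMap k E c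

/-- An anticommuting family together with `1` is linearly independent. -/
theorem IsAnticommFamily.card_lt_finrank {k D : Type*} [Field k] [DivisionRing D] [Algebra k D]
    [FiniteDimensional k D] (h2 : (2 : k) ≠ 0) {m : ℕ} (hm : 2 ≤ m) {u : Fin m → D}
    (hu : IsAnticommFamily k u) : m < Module.finrank k D := by
  have h2D : (2 : D) ≠ 0 := by
    have h := (map_ne_zero (algebraMap k D)).2 h2
    rwa [map_ofNat] at h
  have hne : ∀ i, u i ≠ 0 := by
    intro i hi
    obtain ⟨c, hc, h⟩ := hu.2 i
    rw [hi, mul_zero, eq_comm, map_eq_zero] at h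
    exact hc h
  have hli : LinearIndependent k (fun o : Option (Fin m) => o.elim 1 u) := by
    rw [Fintype.linearIndependent_iff]
    intro g hg
    rw [Fintype.sum_option] at hg
    simp only [Option.elim] at hg
    have key : ∀ i, g none • (1 : D) + g (some i) • u i = 0 := by
      intro i
      have h := congrArg (fun x => u i * x + x * u i) hg
      simp only [mul_add, add_mul, Finset.mul_sum, Finset.sum_mul, mul_zero, zero_mul,
        add_zero] at h
      have hs : ∑ j, u i * g (some j) • u j + ∑ j, (g (some j) • u j) * u i
          = 2 * (g (some i) • (u i * u i)) := by
        rw [← Finset.sum_add_distrib, Finset.sum_eq_single i]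
        · simp [two_mul]
        · intro j _ hji
          rw [mul_smul_comm, smul_mul_assoc, hu.1 j i hji, smul_neg, add_neg_cancel]
        · simp
      have h' : 2 * ((g none • (1 : D) + g (some i) • u i) * u i) = 0 := by
        rw [← h, add_add_add_comm, hs]
        simp [two_mul, mul_add, add_mul]
      exact (mul_eq_zero.1 ((mul_eq_zero.1 h').resolve_left h2D)).resolve_right (hne i)
    have hz : g none = 0 := by
      have a := key ⟨0, by omega⟩
      have b := key ⟨1, by omega⟩
      have hanti := hu.1 ⟨0, by omega⟩ ⟨1, by omega⟩ (by simp)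
      have a' := eq_neg_of_add_eq_zero_right a
      have b' := eq_neg_of_add_eq_zero_right b
      have h := congrArg (fun x => (g (some ⟨0, by omega⟩) * g (some ⟨1, by omega⟩)) • x) hanti
      simp only [smul_neg] at h
      rw [← smul_mul_smul_comm, mul_comm (g _) (g _), ← smul_mul_smul_comm, a', b'] at h
      have h3 : 2 * ((g none • (1 : D)) * (g none • (1 : D))) = 0 := by
        rw [two_mul]
        simpa using eq_neg_iff_add_eq_zero.1 h
      have := (mul_eq_zero.1 h3).resolve_left h2D
      simpa using this
    intro o
    cases o with
    | none => exact hz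
    | some i =>
      have := key i
      rw [hz, zero_smul, zero_add] at this
      exact (smul_eq_zero.1 this).resolve_right (hne i)
  have := hli.fintype_card_le_finrank
  simpa using this

/-- Finitely many anticommuting elements with central integral squares stabilise a right
`R`-submodule of the ring of fractions which contains `1` and has a common denominator. -/
theorem exists_stable_addSubgroup {E' R κ : Type*} [Ring E'] [Ring R] [Fintype κ]
    (ι : R →+* E') (Z : Submonoid R) (hZ : ∀ s ∈ Z, ∀ e, ι s * e = e * ι s)
    (hden : ∀ e, ∃ s ∈ Z, ∃ f, ι s * e = ι f) (u : κ → E')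
    (hanti : ∀ i j, i ≠ j → u i * u j = -(u j * u i))
    (hsq : ∀ i, ∃ f, u i * u i = ι f ∧ ∀ e, ι f * e = e * ι f) :
    ∃ M : AddSubgroup E', (1 : E') ∈ M ∧ (∀ x ∈ M, ∀ f, x * ι f ∈ M) ∧
      (∀ i, ∀ x ∈ M, u i * x ∈ M) ∧ ∃ s ∈ Z, ∀ x ∈ M, ∃ f, ι s * x = ι f := by
  suffices H : ∀ S : Finset κ, ∃ M : AddSubgroup E', (1 : E') ∈ M ∧
      (∀ x ∈ M, ∀ f, x * ι f ∈ M) ∧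
      (∀ i ∈ S, ∀ x ∈ M, u i * x ∈ M) ∧ ∃ s ∈ Z, ∀ x ∈ M, ∃ f, ι s * x = ι f by
    obtain ⟨M, hM⟩ := H Finset.univ
    exact ⟨M, by simpa using hM⟩
  classical
  intro S
  induction S using Finset.induction_on with
  | empty =>
    refine ⟨ι.range.toAddSubgroup, ⟨1, map_one ι⟩, ?_, by simp, 1, Z.one_mem, ?_⟩
    · rintro _ ⟨x, rfl⟩ f
      exact ⟨x * f, map_mul ι _ _⟩
    · rintro _ ⟨x, rfl⟩
      exact ⟨x, by simp⟩
  | insert i S hi ih =>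
    obtain ⟨M, hM1, hMr, hMs, s, hs, hsM⟩ := ih
    obtain ⟨s', hs', f', hf'⟩ := hden (u i)
    obtain ⟨c, hc, hcc⟩ := hsq i
    refine ⟨M ⊔ M.map (AddMonoidHom.mulLeft (u i)), AddSubgroup.mem_sup_left hM1, ?_, ?_,
      s * s', Z.mul_mem hs hs', ?_⟩
    · intro x hx f
      obtain ⟨a, ha, _, ⟨b, hb, rfl⟩, rfl⟩ := AddSubgroup.mem_sup.1 hx
      rw [add_mul]
      refine add_mem (AddSubgroup.mem_sup_left (hMr a ha f)) (AddSubgroup.mem_sup_right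
        ⟨b * ι f, hMr b hb f, ?_⟩)
      simp [mul_assoc]
    · intro j hj x hx
      obtain ⟨a, ha, _, ⟨b, hb, rfl⟩, rfl⟩ := AddSubgroup.mem_sup.1 hx
      simp only [AddMonoidHom.coe_mulLeft]
      rw [mul_add]
      by_cases hji : j = i
      · subst hji
        refine add_mem (AddSubgroup.mem_sup_right ⟨a, ha, rfl⟩) (AddSubgroup.mem_sup_left ?_)
        rw [← mul_assoc, hc, hcc]
        exact hMr b hb c
      · have hjS := (Finset.mem_insert.1 hj).resolve_left hji
        refine add_mem (AddSubgroup.mem_sup_left (hMs j hjS a ha)) (AddSubgroup.mem_sup_right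
          ⟨-(u j * b), neg_mem (hMs j hjS b hb), ?_⟩)
        simp only [AddMonoidHom.coe_mulLeft]
        rw [← mul_assoc, hanti j i hji, mul_neg, neg_mul, mul_assoc]
    · intro x hx
      obtain ⟨a, ha, _, ⟨b, hb, rfl⟩, rfl⟩ := AddSubgroup.mem_sup.1 hx
      obtain ⟨fa, hfa⟩ := hsM a ha
      obtain ⟨fb, hfb⟩ := hsM b hb
      refine ⟨s' * fa + f' * fb, ?_⟩
      simp only [AddMonoidHom.coe_mulLeft, map_add, map_mul]
      rw [← hfa, ← hfb, ← hf', hZ s' hs', mul_add, mul_assoc, mul_assoc, mul_assoc, mul_assoc,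
        hZ s' hs' a, ← mul_assoc (u i), ← hZ s hs (u i), ← mul_assoc (ι s'), ← mul_assoc (ι s'),
        ← mul_assoc (ι s'), hZ s' hs' (ι s)]
      simp only [mul_assoc]

open Polynomial in
/-- A nonzero right ideal of polynomials over a division ring is generated by a monic polynomial. -/
theorem exists_monic_generator {E : Type*} [Ring E] [IsDomain E]
    (hinv : ∀ x : E, x ≠ 0 → IsUnit x)
    (I : AddSubgroup E[X])
    (hI : ∀ f ∈ I, ∀ g, f * g ∈ I) (hne : ∃ f ∈ I, f ≠ 0) :
    ∃ g ∈ I, g.Monic ∧ ∀ f ∈ I, f = g * (f /ₘ g) := by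
  classical
  have monic_of : ∀ f ∈ I, f ≠ 0 → ∃ g ∈ I, g.Monic ∧ g.natDegree = f.natDegree := by
    intro f hf h0
    obtain ⟨c, hc⟩ := (hinv _ (leadingCoeff_ne_zero.2 h0)).exists_right_inv
    refine ⟨f * C c, hI f hf _, monic_mul_C_of_leadingCoeff_mul_eq_one hc, ?_⟩
    rw [natDegree_mul_C (right_ne_zero_of_mul_eq_one hc)]
  have hex : ∃ d, ∃ g ∈ I, g.Monic ∧ g.natDegree = d := by
    obtain ⟨f, hf, h0⟩ := hne
    exact ⟨_, monic_of f hf h0⟩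
  obtain ⟨g, hg, hgm, hgd⟩ := Nat.find_spec hex
  refine ⟨g, hg, hgm, fun f hf => ?_⟩
  have hdiv := modByMonic_add_div f g
  by_cases hr : f %ₘ g = 0
  · rw [hr, zero_add] at hdiv
    exact hdiv.symm
  · exfalso
    have hmem : f %ₘ g ∈ I := by
      rw [eq_sub_of_add_eq hdiv]
      exact sub_mem hf (hI g hg _)
    obtain ⟨g', hg', hm', hd'⟩ := monic_of _ hmem hr
    have hlt := natDegree_lt_natDegree hr (degree_modByMonic_lt f hgm)
    exact Nat.find_min hex (by rwa [← hgd]) ⟨g', hg', hm', hd'⟩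

open Polynomial in
/-- Anticommuting elements of a division ring of rational functions with central polynomial
squares can be simultaneously conjugated into the polynomial ring. -/
theorem exists_polynomial_conjugates {E E' κ : Type*} [Ring E] [IsDomain E] [Ring E'] [Fintype κ]
    (hinv : ∀ x : E, x ≠ 0 → IsUnit x)
    (ι : E[X] →+* E') (hι : Function.Injective ι) (Z : Submonoid E[X]) (h0 : (0 : E[X]) ∉ Z)
    (hZ : ∀ s ∈ Z, ∀ e, ι s * e = e * ι s)
    (hden : ∀ e, ∃ s ∈ Z, ∃ f, ι s * e = ι f) (u : κ → E') (c : κ → E[X])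
    (hanti : ∀ i j, i ≠ j → u i * u j = -(u j * u i))
    (hsq : ∀ i, u i * u i = ι (c i)) (hc : ∀ i e, ι (c i) * e = e * ι (c i)) :
    ∃ w : κ → E[X], (∀ i j, i ≠ j → w i * w j = -(w j * w i)) ∧ ∀ i, w i * w i = c i := by
  obtain ⟨M, hM1, hMr, hMs, s, hs, hsM⟩ :=
    exists_stable_addSubgroup ι Z hZ hden u hanti (fun i => ⟨c i, hsq i, hc i⟩)
  have hs0 : s ≠ 0 := fun h => h0 (h ▸ hs)
  let I : AddSubgroup E[X] := (M.map (AddMonoidHom.mulLeft (ι s))).comap ι.toAddMonoidHom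
  have memI : ∀ f, f ∈ I ↔ ∃ x ∈ M, ι s * x = ι f := fun f => Iff.rfl
  obtain ⟨g, hg, hgm, hgen⟩ := exists_monic_generator hinv I
    (by
      intro f hf g
      obtain ⟨x, hx, hxf⟩ := (memI f).1 hf
      exact (memI _).2 ⟨x * ι g, hMr x hx g, by rw [← mul_assoc, hxf, map_mul]⟩)
    ⟨s, (memI s).2 ⟨1, hM1, mul_one _⟩, hs0⟩
  have hw : ∀ i, ∃ w, u i * ι g = ι g * ι w := by
    intro i
    obtain ⟨x, hx, hxg⟩ := (memI g).1 hg
    obtain ⟨f, hf⟩ := hsM _ (hMs i x hx)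
    refine ⟨f /ₘ g, ?_⟩
    rw [← map_mul, ← hgen f ((memI f).2 ⟨_, hMs i x hx, hf⟩), ← hf, ← hxg, ← mul_assoc,
      ← mul_assoc, hZ s hs]
  choose w hw using hw
  have hmul : ∀ i j, ι (g * (w i * w j)) = u i * u j * ι g := by
    intro i j
    rw [map_mul, map_mul, ← mul_assoc, ← hw, mul_assoc, ← hw, mul_assoc]
  refine ⟨w, fun i j hij => mul_left_cancel₀ hgm.ne_zero (hι ?_), fun i =>
    mul_left_cancel₀ hgm.ne_zero (hι ?_)⟩
  · rw [mul_neg, map_neg, hmul, hmul, hanti i j hij, neg_mul]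
  · rw [hmul, hsq, hc, map_mul]

open Polynomial in
/-- The Cassels–Pfister step: eliminating one variable. -/
theorem exists_anticomm_descent {k E E' : Type*} [Field k] [Ring E] [IsDomain E] [Algebra k E]
    [Ring E'] [Algebra k E'] (hinv : ∀ x : E, x ≠ 0 → IsUnit x) (ι : E[X] →+* E')
    (hι : Function.Injective ι)
    (hιk : ∀ c : k, ι (C (algebraMap k E c)) = algebraMap k E' c)
    (Z : Submonoid E[X]) (h0 : (0 : E[X]) ∉ Z)
    (hZ : ∀ s ∈ Z, ∀ e, ι s * e = e * ι s)
    (hden : ∀ e, ∃ s ∈ Z, ∃ f, ι s * e = ι f) {r : ℕ} (u : Fin r → E')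
    (hu : IsAnticommFamily k u) (v : E') (huv : ∀ i, u i * v = -(v * u i))
    (β : k) (hβ : β ≠ 0) (γ : E)
    (hv : v * v = ι (C (algebraMap k E β) * X ^ 2 + C γ))
    (hvc : ∀ e, (v * v) * e = e * (v * v)) :
    ∃ (w : Fin (r + 1) → E) (z : E), IsAnticommFamily k w ∧ (∀ i, w i * z = -(z * w i)) ∧
      z * z = γ := by
  choose c hc0 hc using hu.2
  obtain ⟨w, hw, hwsq⟩ := exists_polynomial_conjugates hinv ι hι Z h0 hZ hden
    (κ := Option (Fin r)) (fun o => o.elim v u)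
    (fun o => o.elim (C (algebraMap k E β) * X ^ 2 + C γ) (fun i => C (algebraMap k E (c i))))
    (by
      rintro (_ | i) (_ | j) hij
      · exact absurd rfl hij
      · simp [huv j]
      · simpa using huv i
      · simpa using hu.1 i j (by simpa using hij))
    (by
      rintro (_ | i)
      · simpa using hv
      · simpa [hιk] using hc i)
    (by
      rintro (_ | i) e
      · simpa only [Option.elim, hv] using hvc e
      · simpa only [Option.elim, hιk] using Algebra.commutes (c i) e)
  have hconst : ∀ i, ∃ a, w (some i) = C a := by
    intro i
    have h := congrArg natDegree (hwsq (some i))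
    simp only [Option.elim, natDegree_C, ← pow_two, natDegree_pow] at h
    exact ⟨_, eq_C_of_natDegree_eq_zero (by omega)⟩
  choose a ha using hconst
  have hlin : (w none).natDegree ≤ 1 := by
    have h := congrArg natDegree (hwsq none)
    simp only [Option.elim, ← pow_two (w none), natDegree_pow] at h
    have h' : (C (algebraMap k E β) * X ^ 2 + C γ).natDegree ≤ 2 := by compute_degree
    omega
  obtain ⟨b, z, hbz⟩ := exists_eq_X_add_C_of_natDegree_le_one hlin
  have hsq := hwsq none
  simp only [Option.elim, hbz] at hsq
  have hexp : (C b * X + C z) * (C b * X + C z)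
      = C (b * b) * X ^ 2 + C (b * z + z * b) * X + C (z * z) := by
    simp only [mul_add, add_mul, map_mul, map_add, pow_two, mul_assoc]
    rw [← mul_assoc X (C b) X, X_mul_C, X_mul_C]
    simp only [mul_assoc]
    abel
  rw [hexp] at hsq
  have e2 : b * b = algebraMap k E β := by
    simpa [coeff_X, coeff_C, -map_mul, -map_add] using congrArg (fun p => coeff p 2) hsq
  have e1 : b * z + z * b = 0 := by
    simpa [coeff_X, coeff_C, -map_mul, -map_add] using congrArg (fun p => coeff p 1) hsq
  have e0 : z * z = γ := by
    simpa [coeff_X, coeff_C, -map_mul, -map_add] using congrArg (fun p => coeff p 0) hsq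
  have hab : ∀ i, a i * b = -(b * a i) ∧ a i * z = -(z * a i) := by
    intro i
    have h := hw (some i) none (by simp)
    rw [ha, hbz] at h
    constructor
    · simpa [coeff_X, coeff_C] using congrArg (fun p => coeff p 1) h
    · simpa [coeff_X, coeff_C] using congrArg (fun p => coeff p 0) h
  have haa : ∀ i j, i ≠ j → a i * a j = -(a j * a i) := by
    intro i j hij
    have h := hw (some i) (some j) (by simpa using hij)
    rw [ha, ha, ← C_mul, ← C_mul, ← C_neg] at h
    exact C_injective h
  have hasq : ∀ i, a i * a i = algebraMap k E (c i) := by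
    intro i
    have h := hwsq (some i)
    rw [ha, ← C_mul] at h
    exact C_injective h
  refine ⟨Fin.cons b a, z, ⟨?_, ?_⟩, ?_, e0⟩
  · intro i j
    refine Fin.cases ?_ (fun i => ?_) i <;> refine Fin.cases ?_ (fun j => ?_) j
    · simp
    · intro _
      simp [(hab j).1]
    · intro _
      simpa using (hab i).1
    · intro hij
      simpa using haa i j (by simpa using hij)
  · intro i
    refine Fin.cases ⟨β, hβ, e2⟩ (fun i => ⟨c i, hc0 i, hasq i⟩) i
  · intro i
    refine Fin.cases (eq_neg_of_add_eq_zero_left e1) (fun i => (hab i).2) i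

open Polynomial in
/-- The embedding of `E[X]` into `F(X) ⊗ E`. -/
noncomputable def polynomialToFrac (F E : Type*) [Field F] [Ring E] [Algebra F E] :
    E[X] →ₐ[F] FractionRing F[X] ⊗[F] E :=
  ((Algebra.TensorProduct.comm F E (FractionRing F[X])).toAlgHom.comp
    (Algebra.TensorProduct.map (AlgHom.id F E)
      (IsScalarTower.toAlgHom F F[X] (FractionRing F[X])))).comp (polyEquivTensor F E).toAlgHom

section polynomialToFrac
open Polynomial

variable {F E : Type*} [Field F] [Ring E] [Algebra F E]

theorem polynomialToFrac_smul_map (e : E) (s : F[X]) :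
    polynomialToFrac F E (e • s.map (algebraMap F E)) =
      algebraMap F[X] (FractionRing F[X]) s ⊗ₜ e := by
  have h : polyEquivTensor F E (e • s.map (algebraMap F E)) = e ⊗ₜ s := by
    rw [← polyEquivTensor_symm_apply_tmul_eq_smul, AlgEquiv.apply_symm_apply]
  change Algebra.TensorProduct.comm F E (FractionRing F[X])
    (Algebra.TensorProduct.map (AlgHom.id F E) _ (polyEquivTensor F E _)) = _
  rw [h]
  simp

theorem polynomialToFrac_map (s : F[X]) :
    polynomialToFrac F E (s.map (algebraMap F E)) =
      algebraMap F[X] (FractionRing F[X]) s ⊗ₜ 1 := by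
  simpa using polynomialToFrac_smul_map (1 : E) s

theorem polynomialToFrac_injective : Function.Injective (polynomialToFrac F E) := by
  have h : Function.Injective (Algebra.TensorProduct.map (AlgHom.id F E)
      (IsScalarTower.toAlgHom F F[X] (FractionRing F[X]))) :=
    Module.Flat.lTensor_preserves_injective_linearMap (M := E)
      (IsScalarTower.toAlgHom F F[X] (FractionRing F[X])).toLinearMap
      (IsFractionRing.injective F[X] (FractionRing F[X]))
  exact ((Algebra.TensorProduct.comm F E (FractionRing F[X])).injective.comp h).comp
    (polyEquivTensor F E).injective

theorem exists_denominator (e : FractionRing F[X] ⊗[F] E) :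
    ∃ s : F[X], s ≠ 0 ∧ ∃ f, polynomialToFrac F E (s.map (algebraMap F E)) * e =
      polynomialToFrac F E f := by
  induction e using TensorProduct.induction_on with
  | zero => exact ⟨1, one_ne_zero, 0, by simp⟩
  | tmul a e =>
    obtain ⟨x, s, hs, rfl⟩ := IsFractionRing.div_surjective (A := F[X]) a
    have hs0 := nonZeroDivisors.ne_zero hs
    refine ⟨s, hs0, e • x.map (algebraMap F E), ?_⟩
    rw [polynomialToFrac_map, polynomialToFrac_smul_map, Algebra.TensorProduct.tmul_mul_tmul,
      one_mul, mul_div_cancel₀]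
    exact (map_ne_zero_iff _ (IsFractionRing.injective F[X] (FractionRing F[X]))).2 hs0
  | add x y hx hy =>
    obtain ⟨s, hs, f, hf⟩ := hx
    obtain ⟨t, ht, g, hg⟩ := hy
    refine ⟨s * t, mul_ne_zero hs ht,
      t.map (algebraMap F E) * f + s.map (algebraMap F E) * g, ?_⟩
    rw [map_add, map_mul, map_mul, ← hf, ← hg, Polynomial.map_mul, map_mul, mul_add,
      polynomialToFrac_map, polynomialToFrac_map, ← mul_assoc, ← mul_assoc,
      Algebra.TensorProduct.tmul_mul_tmul, Algebra.TensorProduct.tmul_mul_tmul, mul_comm]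

theorem polynomialToFrac_map_comm (s : F[X]) (e : FractionRing F[X] ⊗[F] E) :
    polynomialToFrac F E (s.map (algebraMap F E)) * e =
      e * polynomialToFrac F E (s.map (algebraMap F E)) := by
  rw [polynomialToFrac_map]
  exact Algebra.commutes (algebraMap F[X] (FractionRing F[X]) s) e

theorem isDomain_frac_tensor [IsDomain E] : IsDomain (FractionRing F[X] ⊗[F] E) := by
  have : Nontrivial (FractionRing F[X] ⊗[F] E) :=
    (polynomialToFrac_injective (F := F) (E := E)).nontrivial
  have hcancel : ∀ (s : F[X]) (e : FractionRing F[X] ⊗[F] E), s ≠ 0 →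
      polynomialToFrac F E (s.map (algebraMap F E)) * e = 0 → e = 0 := by
    intro s e hs h
    have hs' := (map_ne_zero_iff _ (IsFractionRing.injective F[X] (FractionRing F[X]))).2 hs
    have h' := congrArg (fun x => ((algebraMap F[X] (FractionRing F[X]) s)⁻¹ ⊗ₜ[F] (1 : E)) * x) h
    simp only [mul_zero] at h'
    rwa [polynomialToFrac_map, ← mul_assoc, Algebra.TensorProduct.tmul_mul_tmul,
      inv_mul_cancel₀ hs', mul_one, ← Algebra.TensorProduct.one_def, one_mul] at h'
  have : NoZeroDivisors (FractionRing F[X] ⊗[F] E) := by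
    refine ⟨fun {x y} hxy => ?_⟩
    obtain ⟨s, hs, f, hf⟩ := exists_denominator x
    obtain ⟨t, ht, g, hg⟩ := exists_denominator y
    have h : f * g = 0 := by
      apply polynomialToFrac_injective (F := F)
      rw [map_mul, map_zero, ← hf, ← hg, polynomialToFrac_map_comm t y, mul_assoc, ← mul_assoc x,
        hxy, zero_mul, mul_zero]
    rcases mul_eq_zero.1 h with rfl | rfl
    · exact Or.inl (hcancel s x hs (by rw [hf, map_zero]))
    · exact Or.inr (hcancel t y ht (by rw [hg, map_zero]))
  exact NoZeroDivisors.to_isDomain _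

end polynomialToFrac

/-- The isomorphism `F' ⊗[F] (F ⊗[k] D) ≃ F' ⊗[k] D` for a not necessarily commutative `D`. -/
noncomputable def cancelBaseChangeAlgEquiv (k F F' D : Type*) [Field k] [Field F] [Field F']
    [Ring D] [Algebra k F] [Algebra k F'] [Algebra F F'] [IsScalarTower k F F'] [Algebra k D] :
    F' ⊗[F] (F ⊗[k] D) ≃ₐ[F'] F' ⊗[k] D :=
  AlgEquiv.symm <| AlgEquiv.ofLinearEquiv
    (TensorProduct.AlgebraTensorModule.cancelBaseChange k F F' F' D).symm
    (by simp [Algebra.TensorProduct.one_def]) <|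
      LinearMap.map_mul_of_map_mul_tmul (fun _ _ _ _ ↦ by simp)

theorem IsAnticommFamily.map {k E E' ι : Type*} [Field k] [Ring E] [Algebra k E] [Ring E']
    [Algebra k E'] {u : ι → E} (hu : IsAnticommFamily k u) (f : E →ₐ[k] E') :
    IsAnticommFamily k (fun i => f (u i)) := by
  refine ⟨fun i j hij => ?_, fun i => ?_⟩
  · rw [← map_mul, ← map_mul, hu.1 i j hij, map_neg]
  · obtain ⟨c, hc, h⟩ := hu.2 i
    exact ⟨c, hc, by rw [← map_mul, h, AlgHom.commutes]⟩

open Polynomial in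
theorem algebraicIndependent_cons_X {k F : Type*} [Field k] [Field F] [Algebra k F] {m : ℕ}
    {t : Fin m → F} (ht : AlgebraicIndependent k t) :
    AlgebraicIndependent k (Fin.cons (algebraMap F[X] (FractionRing F[X]) X)
      (fun i => algebraMap F (FractionRing F[X]) (t i)) : Fin (m + 1) → FractionRing F[X]) := by
  let φ : MvPolynomial (Fin (m + 1)) k →ₐ[k] FractionRing F[X] :=
    ((IsScalarTower.toAlgHom k F[X] (FractionRing F[X])).comp
      (Polynomial.mapAlgHom (MvPolynomial.aeval t))).comp (MvPolynomial.finSuccEquiv k m).toAlgHom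
  have hφ : MvPolynomial.aeval (Fin.cons (algebraMap F[X] (FractionRing F[X]) X)
      (fun i => algebraMap F (FractionRing F[X]) (t i)) : Fin (m + 1) → FractionRing F[X]) = φ := by
    apply MvPolynomial.algHom_ext
    intro i
    refine Fin.cases ?_ (fun i => ?_) i
    · simp [φ, MvPolynomial.finSuccEquiv_X_zero]
    · simp [φ, MvPolynomial.finSuccEquiv_X_succ,
        IsScalarTower.algebraMap_apply F F[X] (FractionRing F[X])]
  rw [AlgebraicIndependent, hφ]
  exact ((IsFractionRing.injective F[X] (FractionRing F[X])).comp
    (Polynomial.map_injective _ ht)).comp (MvPolynomial.finSuccEquiv k m).injective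

open Polynomial in
/-- A purely transcendental extension with a generic value of `∑ bᵢ xᵢ²`, over which anticommuting
square roots of that value descend to `k`-division algebras. -/
theorem exists_generic_field (k : Type u) [Field k] (m : ℕ) (b : Fin m → k)
    (hb : ∀ i, b i ≠ 0) :
    ∃ (F : Type u) (_ : Field F) (_ : Algebra k F) (t : Fin m → F), AlgebraicIndependent k t ∧
      ∀ (D : Type u) [DivisionRing D] [Algebra k D] [FiniteDimensional k D],
        IsDomain (F ⊗[k] D) ∧ ∀ (r : ℕ) (u : Fin r → F ⊗[k] D) (v : F ⊗[k] D),
          IsAnticommFamily k u → (∀ i, u i * v = -(v * u i)) →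
          v * v = algebraMap F (F ⊗[k] D) (∑ i, algebraMap k F (b i) * t i ^ 2) →
          ∃ w : Fin (r + m) → D, IsAnticommFamily k w := by
  induction m with
  | zero =>
    refine ⟨k, inferInstance, inferInstance, Fin.elim0, algebraicIndependent_empty_type, ?_⟩
    intro D _ _ _
    refine ⟨(Algebra.TensorProduct.lid k D).toRingEquiv.toMulEquiv.isDomain _, ?_⟩
    intro r u v hu _ _
    exact ⟨_, hu.map (Algebra.TensorProduct.lid k D).toAlgHom⟩
  | succ m ih =>
    obtain ⟨F, _, _, t, ht, hF⟩ := ih (fun i => b i.succ) (fun i => hb _)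
    refine ⟨FractionRing F[X], inferInstance, inferInstance, _, algebraicIndependent_cons_X ht, ?_⟩
    intro D _ _ _
    obtain ⟨hdom, hD⟩ := hF D
    let e := cancelBaseChangeAlgEquiv k F (FractionRing F[X]) D
    let ek : FractionRing F[X] ⊗[k] D →ₐ[k] FractionRing F[X] ⊗[F] (F ⊗[k] D) :=
      e.symm.toAlgHom.restrictScalars k
    have := isDomain_frac_tensor (F := F) (E := F ⊗[k] D)
    refine ⟨e.symm.toRingEquiv.toMulEquiv.isDomain _, ?_⟩
    intro r u v hu huv hv
    let Z : Submonoid (F ⊗[k] D)[X] :=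
      (nonZeroDivisors F[X]).map (mapRingHom (algebraMap F (F ⊗[k] D)))
    let γ : F := ∑ i : Fin m, algebraMap k F (b i.succ) * t i ^ 2
    have hv' : ek v * ek v = polynomialToFrac F (F ⊗[k] D)
        ((C (algebraMap k F (b 0)) * X ^ 2 +
          C γ).map (algebraMap F (F ⊗[k] D))) := by
      rw [← map_mul, hv, polynomialToFrac_map]
      refine (AlgEquiv.commutes e.symm _).trans (congrArg (· ⊗ₜ[F] 1) ?_)
      simp only [γ, Fin.sum_univ_succ, Fin.cons_zero, Fin.cons_succ, map_add, map_mul, map_pow,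
        map_sum, Algebra.algebraMap_self, RingHom.id_apply]
      simp only [← Polynomial.algebraMap_eq,
        ← IsScalarTower.algebraMap_apply F F[X] (FractionRing F[X]),
        ← IsScalarTower.algebraMap_apply k F (FractionRing F[X])]
    obtain ⟨w, z, hw, hwz, hz⟩ := exists_anticomm_descent (k := k)
      (fun x hx => FiniteDimensional.isUnit F hx)
      (polynomialToFrac F (F ⊗[k] D)).toRingHom polynomialToFrac_injective
      (by
        intro c
        exact AlgHom.commutes ((polynomialToFrac F (F ⊗[k] D)).restrictScalars k) c)
      Z
      (by
        rintro ⟨s, hs, h⟩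
        refine nonZeroDivisors.ne_zero hs (Polynomial.map_injective _
          (algebraMap F (F ⊗[k] D)).injective ?_)
        simpa using h)
      (by
        rintro _ ⟨s, hs, rfl⟩ e
        exact polynomialToFrac_map_comm s e)
      (by
        intro e
        obtain ⟨s, hs, f, hf⟩ := exists_denominator e
        exact ⟨_, ⟨s, mem_nonZeroDivisors_of_ne_zero hs, rfl⟩, f, hf⟩)
      (fun i => ek (u i)) (hu.map ek) (ek v)
      (fun i => by rw [← map_mul, huv, map_neg, map_mul]) (b 0) (hb 0)
      (algebraMap F _ γ)
      (by
        rw [hv']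
        simp [IsScalarTower.algebraMap_apply k F (F ⊗[k] D)])
      (by
        intro e
        rw [hv']
        exact polynomialToFrac_map_comm _ e)
    obtain ⟨w', hw'⟩ := hD (r + 1) w z hw hwz hz
    have hr : r + (m + 1) = r + 1 + m := by omega
    rw [hr]
    exact ⟨w', hw'⟩

theorem finrank_eq_mul_finrank_range_single {L V D : Type*} [Field L] [AddCommGroup V] [Module L V]
    [FiniteDimensional L V] [Ring D] {r : ℕ} (ρ : Matrix (Fin r) (Fin r) D →+* Module.End L V)
    (o : Fin r) :
    Module.finrank L V = r * Module.finrank L (LinearMap.range (ρ (Matrix.single o o 1))) := by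
  have hmul : ∀ i j l (v : V), ρ (Matrix.single i j 1) (ρ (Matrix.single j l 1) v) =
      ρ (Matrix.single i l 1) v := by
    intro i j l v
    rw [← Module.End.mul_apply, ← map_mul, Matrix.single_mul_single_same, mul_one]
  have hmul0 : ∀ i j j' l (v : V), j ≠ j' →
      ρ (Matrix.single i j 1) (ρ (Matrix.single j' l 1) v) = 0 := by
    intro i j j' l v h
    rw [← Module.End.mul_apply, ← map_mul, Matrix.single_mul_single_of_ne _ _ _ _ h, map_zero,
      LinearMap.zero_apply]
  have hsum : ∀ v : V, ∑ i, ρ (Matrix.single i i 1) v = v := by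
    intro v
    rw [← LinearMap.sum_apply, ← map_sum, Matrix.sum_single_one, map_one, Module.End.one_apply]
  let e : V ≃ₗ[L] (Fin r → LinearMap.range (ρ (Matrix.single o o 1))) :=
    { toFun := fun v i => ⟨ρ (Matrix.single o i 1) v, ρ (Matrix.single o i 1) v, hmul o o i v⟩
      map_add' := fun v w => by ext i; simp
      map_smul' := fun c v => by ext i; simp
      invFun := fun w => ∑ i, ρ (Matrix.single i o 1) (w i)
      left_inv := fun v => by simp only [hmul, hsum]
      right_inv := fun w => by
        ext i
        simp only [map_sum]
        rw [Finset.sum_eq_single i]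
        · obtain ⟨x, hx⟩ := (w i).2
          rw [hmul, ← hx, hmul]
        · intro j _ hj
          exact hmul0 _ _ _ _ _ hj.symm
        · simp }
  rw [e.finrank_eq, Module.finrank_pi_fintype]
  simp

/-- A nontrivial division algebra split by a quadratic extension `L = F(√δ)` of `F` over which it
remains a division algebra is of dimension `4`, and `δ` becomes a square in it. -/
theorem exists_sq_eq_of_splits {k D F L : Type*} [Field k] [DivisionRing D] [Algebra k D]
    [FiniteDimensional k D] [Field F] [Field L] [Algebra k F] [Algebra k L] [Algebra F L]
    [IsScalarTower k F L] [IsDomain (F ⊗[k] D)] (hFL : Module.finrank F L = 2)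
    {r N : ℕ} [NeZero r] [NeZero N]
    (φ : Matrix (Fin r) (Fin r) D →ₐ[k] Matrix (Fin N) (Fin N) L)
    (hdim : N ^ 2 = r ^ 2 * Module.finrank k D) (hD : Module.finrank k D ≠ 1)
    (s : L) (δ : F) (hs : s * s = algebraMap F L δ) :
    Module.finrank k D = 4 ∧ ∃ x : F ⊗[k] D, x * x = algebraMap F _ δ := by
  have : FiniteDimensional F L := Module.finite_of_finrank_eq_succ hFL
  let ρ : Matrix (Fin r) (Fin r) D →ₐ[k] Module.End L (Fin N → L) :=
    ((Matrix.toLinAlgEquiv' (R := L) (n := Fin N)).toAlgHom.restrictScalars k).comp φ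
  let W := LinearMap.range (ρ (Matrix.single 0 0 1))
  have hN : N = r * Module.finrank L W := by
    simpa using finrank_eq_mul_finrank_range_single (L := L) (V := Fin N → L) ρ.toRingHom 0
  have hr0 : r ≠ 0 := NeZero.ne r
  have hd : Module.finrank k D = Module.finrank L W ^ 2 := by
    rw [hN, mul_pow] at hdim
    exact (Nat.eq_of_mul_eq_mul_left (by positivity) hdim).symm
  have hW0 : Module.finrank L W ≠ 0 := by
    intro h
    rw [h, mul_zero] at hN
    exact NeZero.ne N hN
  have hWnt : Nontrivial W := Module.nontrivial_of_finrank_pos (R := L) (Nat.pos_of_ne_zero hW0)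
  obtain ⟨⟨w, hwW⟩, hw⟩ := exists_ne (0 : W)
  have hw0 : w ≠ 0 := fun h => hw (Subtype.ext h)
  have hcomm : ∀ (f : F) (d : D), Commute (Algebra.ofId F (Module.End L (Fin N → L)) f)
      (ρ.comp (Matrix.scalarAlgHom (Fin r) k) d) := fun f d => Algebra.commutes f _
  let α : F ⊗[k] D →ₐ[F] Module.End L (Fin N → L) :=
    Algebra.TensorProduct.lift (Algebra.ofId F _)
      (ρ.comp (Matrix.scalarAlgHom (Fin r) k)) hcomm
  have hα : ∀ (f : F) (d : D) (v : Fin N → L),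
      α (f ⊗ₜ d) v = f • ρ (Matrix.scalarAlgHom (Fin r) k d) v := by
    intro f d v
    change (Algebra.TensorProduct.lift (Algebra.ofId F (Module.End L (Fin N → L)))
      (ρ.comp (Matrix.scalarAlgHom (Fin r) k)) hcomm (f ⊗ₜ d)) v = _
    rw [Algebra.TensorProduct.lift_tmul, Module.End.mul_apply, Algebra.ofId_apply,
      Module.algebraMap_end_apply, AlgHom.comp_apply]
  have hαW : ∀ (e : F ⊗[k] D), α e w ∈ W := by
    intro e
    induction e using TensorProduct.induction_on with
    | zero => simp
    | add x y hx hy => simpa using add_mem hx hy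
    | tmul f d =>
      obtain ⟨v, hv⟩ := hwW
      rw [hα, ← algebraMap_smul L]
      refine W.smul_mem _ ⟨ρ (Matrix.scalarAlgHom (Fin r) k d) v, ?_⟩
      rw [← hv, ← Module.End.mul_apply, ← Module.End.mul_apply, ← map_mul, ← map_mul]
      congr 2
      ext i j
      simp [Matrix.scalarAlgHom, Matrix.single_apply]
  let θ : F ⊗[k] D →ₗ[F] W :=
    { toFun := fun e => ⟨α e w, hαW e⟩
      map_add' := fun x y => by ext; simp
      map_smul' := fun c x => by ext; simp }
  have hθ : Function.Injective θ := by
    rw [injective_iff_map_eq_zero]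
    intro e he
    by_contra hne
    have he' : α e w = 0 := congrArg Subtype.val he
    obtain ⟨e', hee⟩ := (FiniteDimensional.isUnit F hne).exists_left_inv
    apply hw0
    rw [← Module.End.one_apply (R := L) w, ← map_one α, ← hee, map_mul, Module.End.mul_apply, he',
      map_zero]
  have hWF : Module.finrank F W = 2 * Module.finrank L W := by
    rw [← hFL, Module.finrank_mul_finrank]
  have hED : Module.finrank F (F ⊗[k] D) = Module.finrank L W ^ 2 := by
    rw [Module.finrank_baseChange, hd]
  have : FiniteDimensional F W := Module.Finite.trans L W
  have hle := LinearMap.finrank_le_finrank_of_injective hθ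
  rw [hWF, hED] at hle
  have hd2 : Module.finrank L W = 2 := by
    have h1 : Module.finrank L W ≠ 1 := fun h => hD (by rw [hd, h, one_pow])
    have : Module.finrank L W ≤ 2 := by
      by_contra! h
      nlinarith
    omega
  have hsurj : Function.Surjective θ := by
    refine (LinearMap.injective_iff_surjective_of_finrank_eq_finrank ?_).1 hθ
    rw [hWF, hED, hd2]
    norm_num
  refine ⟨by rw [hd, hd2]; norm_num, ?_⟩
  obtain ⟨x, hx⟩ := hsurj ⟨s • w, W.smul_mem s hwW⟩
  have hx' : α x w = s • w := congrArg Subtype.val hx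
  refine ⟨x, hθ (Subtype.ext ?_)⟩
  change α (x * x) w = α (algebraMap F _ δ) w
  rw [map_mul, Module.End.mul_apply, hx', map_smul, hx', smul_smul, hs, AlgHom.commutes,
    Module.algebraMap_end_apply, algebraMap_smul]

theorem irreducible_X_sq_sub_C {F : Type*} [Field F] {δ : F} (hδ : ¬ IsSquare δ) :
    Irreducible (Polynomial.X ^ 2 - Polynomial.C δ) := by
  rw [Polynomial.irreducible_iff_roots_eq_zero_of_degree_le_three
    (by rw [Polynomial.natDegree_X_pow_sub_C]) (by rw [Polynomial.natDegree_X_pow_sub_C]; omega),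
    Multiset.eq_zero_iff_forall_notMem]
  intro x hx
  have hroot := Polynomial.isRoot_of_mem_roots hx
  simp only [Polynomial.IsRoot, Polynomial.eval_sub, Polynomial.eval_pow, Polynomial.eval_X,
    Polynomial.eval_C, sub_eq_zero] at hroot
  exact hδ ⟨x, by rw [← hroot, sq]⟩

theorem finSuccEquiv_sq_sub_sum {k : Type*} [CommRing k] {m : ℕ} (b : Fin m → k) :
    MvPolynomial.finSuccEquiv k m (MvPolynomial.X 0 ^ 2 -
      ∑ i : Fin m, MvPolynomial.C (b i) * MvPolynomial.X i.succ ^ 2) =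
    Polynomial.X ^ 2 - Polynomial.C (∑ i, MvPolynomial.C (b i) * MvPolynomial.X i ^ 2) := by
  have hC : ∀ c : k, MvPolynomial.finSuccEquiv k m (MvPolynomial.C c) =
      Polynomial.C (MvPolynomial.C c) := fun c => by simp [MvPolynomial.finSuccEquiv_apply]
  simp only [map_sub, map_pow, map_sum, map_mul, MvPolynomial.finSuccEquiv_X_zero,
    MvPolynomial.finSuccEquiv_X_succ, hC]

/-- The point `(√δ, t₁, …, tₘ)` is a generic zero of `X₀² - ∑ bᵢ Xᵢ²`. -/
theorem mvPolynomial_dvd_of_aeval_eq_zero {k F L : Type*} [Field k] [Field F] [Field L]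
    [Algebra k F] [Algebra k L] [Algebra F L] [IsScalarTower k F L] {m : ℕ} {t : Fin m → F}
    (ht : AlgebraicIndependent k t) (b : Fin m → k)
    (hsq : ¬ IsSquare (∑ i, algebraMap k F (b i) * t i ^ 2)) {s : L}
    (hs : s * s = algebraMap F L (∑ i, algebraMap k F (b i) * t i ^ 2))
    (f : MvPolynomial (Fin (m + 1)) k)
    (hf : MvPolynomial.aeval (Fin.cons s (fun i => algebraMap F L (t i)) : Fin (m + 1) → L) f = 0) :
    (MvPolynomial.X 0 ^ 2 - ∑ i, MvPolynomial.C (b i) * MvPolynomial.X i.succ ^ 2 :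
      MvPolynomial (Fin (m + 1)) k) ∣ f := by
  set δ := ∑ i, algebraMap k F (b i) * t i ^ 2 with hδ
  have hmin : minpoly F s = Polynomial.X ^ 2 - Polynomial.C δ := by
    symm
    apply minpoly.eq_of_irreducible_of_monic
    · exact irreducible_X_sq_sub_C hsq
    · simp [← hs, sq]
    · exact Polynomial.monic_X_pow_sub_C _ two_ne_zero
  have heval : ∀ g : MvPolynomial (Fin (m + 1)) k,
      Polynomial.aeval s ((MvPolynomial.finSuccEquiv k m g).map
        (MvPolynomial.aeval t : MvPolynomial (Fin m) k →ₐ[k] F).toRingHom) =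
      MvPolynomial.aeval (Fin.cons s (fun i => algebraMap F L (t i)) : Fin (m + 1) → L) g := by
    intro g
    induction g using MvPolynomial.induction_on with
    | C a => simp [MvPolynomial.finSuccEquiv_apply, IsScalarTower.algebraMap_apply k F L]
    | add p q hp hq => simp only [map_add, Polynomial.map_add, hp, hq]
    | mul_X p i hp =>
      rw [map_mul, Polynomial.map_mul, map_mul, hp, map_mul]
      congr 1
      refine Fin.cases ?_ (fun i => ?_) i
      · simp [MvPolynomial.finSuccEquiv_X_zero]
      · simp [MvPolynomial.finSuccEquiv_X_succ]
  have hdvd := minpoly.dvd F s ((heval f).trans hf)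
  rw [hmin] at hdvd
  have hmap : (Polynomial.X ^ 2 - Polynomial.C (∑ i, MvPolynomial.C (b i) * MvPolynomial.X i ^ 2 :
      MvPolynomial (Fin m) k)).map (MvPolynomial.aeval t : MvPolynomial (Fin m) k →ₐ[k] F).toRingHom
      = Polynomial.X ^ 2 - Polynomial.C δ := by
    simp [hδ, Polynomial.map_sum]
  rw [← hmap, Polynomial.map_dvd_map _ ht (Polynomial.monic_X_pow_sub_C _ two_ne_zero)] at hdvd
  rw [← finSuccEquiv_sq_sub_sum] at hdvd
  obtain ⟨g, hg⟩ := hdvd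
  refine ⟨(MvPolynomial.finSuccEquiv k m).symm g, (MvPolynomial.finSuccEquiv k m).injective ?_⟩
  rw [hg, map_mul, AlgEquiv.apply_symm_apply]

theorem cons_sum_ne_zero {k F L : Type*} [Field k] [Field F] [Field L]
    [Algebra k F] [Algebra k L] [Algebra F L] [IsScalarTower k F L] {m : ℕ} {t : Fin m → F}
    (ht : AlgebraicIndependent k t) {δ : F} (hsq : ¬ IsSquare δ) {s : L}
    (hs : s * s = algebraMap F L δ) {c : Fin (m + 1) → k} (hc : c ≠ 0) :
    ∑ i, algebraMap k L (c i) *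
      (Fin.cons s (fun i => algebraMap F L (t i)) : Fin (m + 1) → L) i ≠ 0 := by
  intro h
  rw [Fin.sum_univ_succ] at h
  simp only [Fin.cons_zero, Fin.cons_succ, IsScalarTower.algebraMap_apply k F L, ← map_mul,
    ← map_sum] at h
  have hc0 : c 0 = 0 := by
    by_contra hc0
    have hc0' : algebraMap k F (c 0) ≠ 0 := by simpa using hc0
    have hs' : s = algebraMap F L (-(algebraMap k F (c 0))⁻¹ *
        ∑ i : Fin m, algebraMap k F (c i.succ) * t i) := by
      have h0 : algebraMap F L (algebraMap k F (c 0)) ≠ 0 := by simpa using hc0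
      rw [map_mul, map_neg, map_inv₀]
      field_simp
      linear_combination h
    apply hsq
    rw [hs', ← map_mul] at hs
    exact ⟨_, ((algebraMap F L).injective hs).symm⟩
  rw [hc0, map_zero, map_zero, zero_mul, zero_add, map_eq_zero] at h
  apply hc
  have hli := Fintype.linearIndependent_iff.1 ht.linearIndependent (fun i => c i.succ)
    (by simpa [Algebra.smul_def] using h)
  funext i
  refine Fin.cases hc0 hli i

theorem extendQF_apply {R : Type*} [CommRing R] {n : ℕ} (q : QuadraticForm R (Fin n → R))
    (l : Type*) [CommRing l] [Algebra R l] (v : Fin n → l) :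
    extendQF q l v = v ⬝ᵥ ((coeffMatrix q).map (algebraMap R l)).mulVec v := by
  unfold extendQF
  exact Matrix.toLinearMap₂'_apply' ((coeffMatrix q).map (algebraMap R l)) v v

theorem map_extendQF {R : Type*} [CommRing R] {n : ℕ} (q : QuadraticForm R (Fin n → R))
    {l l' : Type*} [CommRing l] [Algebra R l] [CommRing l'] [Algebra R l'] (σ : l →ₐ[R] l')
    (v : Fin n → l) : σ (extendQF q l v) = extendQF q l' (fun i => σ (v i)) := by
  simp [extendQF_apply, dotProduct, Matrix.mulVec]

theorem coeffMatrix_add_transpose {R : Type*} [CommRing R] {n : ℕ}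
    (q : QuadraticForm R (Fin n → R)) :
    coeffMatrix q + (coeffMatrix q).transpose = polarMatrix q := by
  ext i j
  simp only [coeffMatrix, polarMatrix, Matrix.add_apply, Matrix.transpose_apply, Matrix.of_apply]
  rcases lt_trichotomy i j with h | rfl | h
  · simp [h, h.ne, h.ne', h.not_gt]
  · simp [two_mul]
  · simp [h, h.ne, h.ne', h.not_gt, QuadraticMap.polar_comm]

theorem two_mul_extendQF {R : Type*} [CommRing R] {n : ℕ} (q : QuadraticForm R (Fin n → R))
    (l : Type*) [CommRing l] [Algebra R l] (v : Fin n → l) :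
    2 * extendQF q l v = v ⬝ᵥ ((polarMatrix q).map (algebraMap R l)).mulVec v := by
  rw [← coeffMatrix_add_transpose, Matrix.map_add _ (map_add _), Matrix.add_mulVec, dotProduct_add,
    Matrix.transpose_map, Matrix.mulVec_transpose, dotProduct_comm v (Matrix.vecMul _ _),
    ← Matrix.dotProduct_mulVec, ← extendQF_apply, two_mul]

theorem exists_diagonalization {k : Type*} [Field k] (h2 : (2 : k) ≠ 0) {n : ℕ}
    (q : QuadraticForm k (Fin n → k)) (hq : NondegQF q) :
    ∃ (P : Matrix (Fin n) (Fin n) k) (a : Fin n → k), IsUnit P.det ∧ (∀ i, a i ≠ 0) ∧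
      ∀ (l : Type*) [CommRing l] [Algebra k l] (y : Fin n → l),
        extendQF q l ((P.map (algebraMap k l)).mulVec y) = ∑ i, algebraMap k l (a i) * y i ^ 2 := by
  have := invertibleOfNonzero h2
  have hS : (polarMatrix q).IsSymm := by
    ext i j
    simp [polarMatrix, QuadraticMap.polar_comm]
  have hB : LinearMap.IsSymm (Matrix.toBilin' (polarMatrix q)) := by
    refine ⟨fun x y => ?_⟩
    rw [RingHom.id_apply, Matrix.toBilin'_apply', Matrix.toBilin'_apply', dotProduct_comm, ← hS,
      Matrix.mulVec_transpose, ← Matrix.dotProduct_mulVec, hS]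
  obtain ⟨v₀, hv₀⟩ := LinearMap.BilinForm.exists_orthogonal_basis hB
  have hn : Module.finrank k (Fin n → k) = n := by simp
  let v := v₀.reindex (finCongr hn)
  have hv : ∀ i j, i ≠ j → Matrix.toBilin' (polarMatrix q) (v i) (v j) = 0 := by
    intro i j hij
    simp only [v, Module.Basis.reindex_apply]
    exact hv₀ (fun h => hij ((finCongr hn).symm.injective h))
  let P : Matrix (Fin n) (Fin n) k := Matrix.of fun i j => v j i
  let d : Fin n → k := fun i => Matrix.toBilin' (polarMatrix q) (v i) (v i)
  have hP : IsUnit P.det := by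
    have h := v.toMatrix_mul_toMatrix_flip (Pi.basisFun k (Fin n))
    have hP' : P = (Pi.basisFun k (Fin n)).toMatrix v := by
      ext i j
      simp [P, Module.Basis.toMatrix_apply]
    have h' := (Pi.basisFun k (Fin n)).toMatrix_mul_toMatrix_flip v
    rw [← hP'] at h'
    exact Matrix.isUnit_det_of_right_inverse h'
  have hPSP : P.transpose * polarMatrix q * P = Matrix.diagonal d := by
    ext i j
    have : (P.transpose * polarMatrix q * P) i j = Matrix.toBilin' (polarMatrix q) (v i) (v j) := by
      rw [Matrix.toBilin'_apply', Matrix.mul_assoc, Matrix.mul_apply]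
      simp [dotProduct, Matrix.mulVec, Matrix.mul_apply, P]
    rw [this]
    by_cases h : i = j
    · subst h
      simp [d]
    · rw [hv i j h, Matrix.diagonal_apply_ne _ h]
  have hd : ∀ i, d i ≠ 0 := by
    have h := congrArg Matrix.det hPSP
    rw [Matrix.det_mul, Matrix.det_mul, Matrix.det_transpose, Matrix.det_diagonal] at h
    have h0 : ∏ i, d i ≠ 0 := by
      rw [← h]
      exact mul_ne_zero (mul_ne_zero hP.ne_zero hq) hP.ne_zero
    intro i
    exact Finset.prod_ne_zero_iff.1 h0 i (Finset.mem_univ i)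
  refine ⟨P, fun i => d i / 2, hP, fun i => div_ne_zero (hd i) h2, ?_⟩
  intro l _ _ y
  have h2l : IsUnit (2 : l) := by
    have := (IsUnit.mk0 _ h2).map (algebraMap k l)
    rwa [map_ofNat] at this
  apply h2l.mul_left_cancel
  rw [two_mul_extendQF, Matrix.dotProduct_mulVec, Matrix.vecMul_mulVec, ← Matrix.dotProduct_mulVec,
    Matrix.mulVec_mulVec, ← Matrix.transpose_map, ← Matrix.map_mul, ← Matrix.map_mul, hPSP]
  simp only [dotProduct, Finset.mul_sum]
  apply Finset.sum_congr rfl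
  intro i _
  rw [Matrix.diagonal_map (map_zero _), Matrix.mulVec_diagonal]
  have : algebraMap k l (d i) = 2 * algebraMap k l (d i / 2) := by
    rw [← map_ofNat (algebraMap k l) 2, ← map_mul, mul_div_cancel₀ _ h2]
  rw [this]
  ring

theorem exists_homogenization {k L : Type*} [Field k] [Field L] [Algebra k L] {n : ℕ} (hn : 0 < n)
    (z : Fin n → L) (hz : z ⟨n - 1, by omega⟩ ≠ 0) (f : MvPolynomial (Fin (n - 1)) k) :
    ∃ (N : ℕ) (g : MvPolynomial (Fin n) k),
      MvPolynomial.aeval (fun i : Fin n => if h : (i : ℕ) < n - 1 then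
        (MvPolynomial.X ⟨i, h⟩ : MvPolynomial (Fin (n - 1)) k) else 1) g = f ∧
      MvPolynomial.aeval z g = z ⟨n - 1, by omega⟩ ^ N *
        MvPolynomial.aeval (fun i : Fin (n - 1) => z ⟨i, by omega⟩ / z ⟨n - 1, by omega⟩) f := by
  induction f using MvPolynomial.induction_on with
  | C c => exact ⟨0, MvPolynomial.C c, by simp [MvPolynomial.algebraMap_eq], by simp⟩
  | add f₁ f₂ h₁ h₂ =>
    obtain ⟨N₁, g₁, hg₁, hg₁'⟩ := h₁
    obtain ⟨N₂, g₂, hg₂, hg₂'⟩ := h₂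
    refine ⟨N₁ + N₂, MvPolynomial.X ⟨n - 1, by omega⟩ ^ N₂ * g₁ +
      MvPolynomial.X ⟨n - 1, by omega⟩ ^ N₁ * g₂, ?_, ?_⟩
    · simp only [map_add, map_mul, map_pow, MvPolynomial.aeval_X, hg₁, hg₂, lt_irrefl, dite_false,
        one_pow, one_mul]
    · simp only [map_add, map_mul, map_pow, MvPolynomial.aeval_X, hg₁', hg₂']
      ring
  | mul_X f i h =>
    obtain ⟨N, g, hg, hg'⟩ := h
    refine ⟨N + 1, g * MvPolynomial.X ⟨i, by omega⟩, ?_, ?_⟩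
    · simp only [map_mul, MvPolynomial.aeval_X, hg, i.isLt, dite_true]
    · simp only [map_mul, MvPolynomial.aeval_X, hg']
      field_simp
      ring

/-- A generic zero `z` of `q` in `L` induces an embedding of the function field of `q`. -/
theorem nonempty_algHom_quadricFunctionField {k L : Type*} [Field k] [Field L] [Algebra k L] {n : ℕ}
    (hn : 0 < n) (q : QuadraticForm k (Fin n → k)) (z : Fin n → L)
    (hz : z ⟨n - 1, by omega⟩ ≠ 0) (hqz : extendQF q L z = 0)
    (hker : ∀ g : MvPolynomial (Fin n) k, MvPolynomial.aeval z g = 0 →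
      extendQF q (MvPolynomial (Fin n) k) MvPolynomial.X ∣ g) :
    Nonempty (quadricFunctionField q →ₐ[k] L) := by
  let ψ : MvPolynomial (Fin (n - 1)) k →ₐ[k] L :=
    MvPolynomial.aeval (fun i : Fin (n - 1) => z ⟨i, by omega⟩ / z ⟨n - 1, by omega⟩)
  have hψ : ψ (affineQuadricPoly q) = 0 := by
    unfold affineQuadricPoly
    rw [map_extendQF]
    have : (fun i : Fin n => ψ (if h : (i : ℕ) < n - 1 then MvPolynomial.X ⟨i, h⟩ else 1)) =
        (z ⟨n - 1, by omega⟩)⁻¹ • z := by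
      funext i
      by_cases h : (i : ℕ) < n - 1
      · simp [h, ψ, div_eq_inv_mul]
      · have hi : i = ⟨n - 1, by omega⟩ := Fin.ext (by simp; omega)
        simp [h, ← hi, show z i ≠ 0 from hi ▸ hz]
    rw [this, QuadraticMap.map_smul, hqz, smul_zero]
  have hle : ∀ f ∈ Ideal.span {affineQuadricPoly q}, ψ f = 0 := by
    intro f hf
    obtain ⟨g, rfl⟩ := Ideal.mem_span_singleton.1 hf
    rw [map_mul, hψ, zero_mul]
  let χ : quadricCoordRing q →ₐ[k] L := Ideal.Quotient.liftₐ _ ψ hle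
  have hχ : Function.Injective χ := by
    rw [injective_iff_map_eq_zero]
    intro x hx
    obtain ⟨f, rfl⟩ := Ideal.Quotient.mk_surjective x
    have hf : ψ f = 0 := hx
    obtain ⟨N, g, hg, hg'⟩ := exists_homogenization hn z hz f
    obtain ⟨c, hc⟩ := hker g (by rw [hg']; exact mul_eq_zero_of_right _ hf)
    rw [Ideal.Quotient.eq_zero_iff_mem, Ideal.mem_span_singleton, ← hg, hc, map_mul, map_extendQF]
    simp only [MvPolynomial.aeval_X]
    exact dvd_mul_right _ _
  have hdom : IsDomain (quadricCoordRing q) := hχ.isDomain χ.toRingHom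
  exact ⟨IsFractionRing.liftAlgHom hχ⟩

theorem map_mulVec_map {R S T : Type*} [CommRing R] [CommRing S] [CommRing T] [Algebra R S]
    [Algebra R T] {n : ℕ} (Q : Matrix (Fin n) (Fin n) R) (σ : S →ₐ[R] T) (v : Fin n → S)
    (i : Fin n) : σ ((Q.map (algebraMap R S)).mulVec v i) =
      (Q.map (algebraMap R T)).mulVec (fun j => σ (v j)) i := by
  simp [Matrix.mulVec, dotProduct]

theorem nonempty_algHom_quadricFunctionField_of_diagonalization {k F L : Type*} [Field k] [Field F]
    [Field L] [Algebra k F] [Algebra k L] [Algebra F L] [IsScalarTower k F L] {m : ℕ}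
    {t : Fin m → F} (ht : AlgebraicIndependent k t) (q : QuadraticForm k (Fin (m + 1) → k))
    (P : Matrix (Fin (m + 1)) (Fin (m + 1)) k) (hP : IsUnit P.det)
    (a : Fin (m + 1) → k) (ha : a 0 ≠ 0)
    (hL : ∀ y : Fin (m + 1) → L,
      extendQF q L ((P.map (algebraMap k L)).mulVec y) = ∑ i, algebraMap k L (a i) * y i ^ 2)
    (hX : ∀ y : Fin (m + 1) → MvPolynomial (Fin (m + 1)) k,
      extendQF q (MvPolynomial (Fin (m + 1)) k) ((P.map (algebraMap k _)).mulVec y) =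
        ∑ i, algebraMap k (MvPolynomial (Fin (m + 1)) k) (a i) * y i ^ 2)
    (hsq : ¬ IsSquare (∑ i : Fin m, algebraMap k F (-(a i.succ / a 0)) * t i ^ 2)) {s : L}
    (hs : s * s = algebraMap F L (∑ i : Fin m, algebraMap k F (-(a i.succ / a 0)) * t i ^ 2)) :
    Nonempty (quadricFunctionField q →ₐ[k] L) := by
  set y : Fin (m + 1) → L := Fin.cons s (fun i => algebraMap F L (t i)) with hy
  have ha' : algebraMap k L (a 0) ≠ 0 := by simpa using ha
  refine nonempty_algHom_quadricFunctionField m.succ_pos q ((P.map (algebraMap k L)).mulVec y)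
    ?_ ?_ ?_
  · have hrow : P (Fin.last m) ≠ 0 := by
      intro h
      apply hP.ne_zero
      exact Matrix.det_eq_zero_of_row_eq_zero (Fin.last m) (fun j => congrFun h j)
    exact cons_sum_ne_zero ht hsq hs hrow
  · rw [hL, Fin.sum_univ_succ]
    simp only [hy, Fin.cons_zero, Fin.cons_succ, sq s, hs, map_sum, map_mul, map_pow, map_neg,
      map_div₀, ← IsScalarTower.algebraMap_apply k F L, Finset.mul_sum, ← Finset.sum_add_distrib]
    apply Finset.sum_eq_zero
    intro i _
    field_simp
    ring
  · intro g hg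
    let sub : Matrix (Fin (m + 1)) (Fin (m + 1)) k →
        MvPolynomial (Fin (m + 1)) k →ₐ[k] MvPolynomial (Fin (m + 1)) k := fun Q =>
      MvPolynomial.aeval ((Q.map (algebraMap k _)).mulVec MvPolynomial.X)
    have hsubX : ∀ (Q : Matrix (Fin (m + 1)) (Fin (m + 1)) k),
        (fun j => sub Q (MvPolynomial.X j)) = (Q.map (algebraMap k _)).mulVec MvPolynomial.X := by
      intro Q
      funext j
      exact MvPolynomial.aeval_X _ _
    have hzero : MvPolynomial.aeval y (sub P g) = 0 := by
      rw [← hg]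
      change ((MvPolynomial.aeval y).comp (sub P)) g = _
      congr 1
      apply MvPolynomial.algHom_ext
      intro i
      rw [AlgHom.comp_apply, congrFun (hsubX P) i, map_mulVec_map]
      simp
    obtain ⟨h, hh⟩ :=
      mvPolynomial_dvd_of_aeval_eq_zero ht (fun i => -(a i.succ / a 0)) hsq hs _ hzero
    have hinv : sub P⁻¹ (sub P g) = g := by
      change ((sub P⁻¹).comp (sub P)) g = AlgHom.id k _ g
      congr 1
      apply MvPolynomial.algHom_ext
      intro i
      rw [AlgHom.comp_apply, congrFun (hsubX P) i, map_mulVec_map, hsubX, Matrix.mulVec_mulVec,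
        ← Matrix.map_mul, Matrix.mul_nonsing_inv P hP,
        Matrix.map_one _ (map_zero _) (map_one _), Matrix.one_mulVec, AlgHom.id_apply]
    have hquad : extendQF q (MvPolynomial (Fin (m + 1)) k) MvPolynomial.X =
        MvPolynomial.C (a 0) * sub P⁻¹ (MvPolynomial.X 0 ^ 2 -
          ∑ i : Fin m, MvPolynomial.C (-(a i.succ / a 0)) * MvPolynomial.X i.succ ^ 2) := by
      have hXX : extendQF q (MvPolynomial (Fin (m + 1)) k) MvPolynomial.X =
          sub P⁻¹ (extendQF q (MvPolynomial (Fin (m + 1)) k)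
            ((P.map (algebraMap k _)).mulVec MvPolynomial.X)) := by
        rw [map_extendQF]
        congr 1
        funext i
        rw [map_mulVec_map, hsubX, Matrix.mulVec_mulVec, ← Matrix.map_mul,
          Matrix.mul_nonsing_inv P hP, Matrix.map_one _ (map_zero _) (map_one _),
          Matrix.one_mulVec]
      have hC : (MvPolynomial.C (a 0) : MvPolynomial (Fin (m + 1)) k) =
          sub P⁻¹ (MvPolynomial.C (a 0)) :=
        ((sub P⁻¹).commutes (a 0)).symm
      rw [hXX, hX, hC, ← map_mul]
      congr 1
      rw [Fin.sum_univ_succ, mul_sub, sub_eq_add_neg, MvPolynomial.algebraMap_eq, Finset.mul_sum,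
        ← Finset.sum_neg_distrib]
      congr 2
      funext i
      rw [← mul_assoc, ← map_mul, mul_neg, mul_div_cancel₀ _ ha, map_neg, neg_mul, neg_neg]
    refine ⟨MvPolynomial.C (a 0)⁻¹ * sub P⁻¹ h, ?_⟩
    rw [hquad, ← hinv, hh, map_mul]
    have hC : (MvPolynomial.C (a 0) : MvPolynomial (Fin (m + 1)) k) *
        MvPolynomial.C (a 0)⁻¹ = 1 := by
      rw [← map_mul, mul_inv_cancel₀ ha, map_one]
    linear_combination (-(sub P⁻¹ (MvPolynomial.X 0 ^ 2 -
          ∑ i : Fin m, MvPolynomial.C (-(a i.succ / a 0)) * MvPolynomial.X i.succ ^ 2)) *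
        sub P⁻¹ h) * hC

theorem not_isSquare_generic {k F : Type u} [Field k] (h2 : (2 : k) ≠ 0) [Field F] [Algebra k F]
    {m : ℕ} (hm : 2 ≤ m) {δ : F}
    (hF : ∀ v : F ⊗[k] k, v * v = algebraMap F (F ⊗[k] k) δ →
      ∃ w : Fin (0 + m) → k, IsAnticommFamily k w) : ¬ IsSquare δ := by
  rintro ⟨x, hx⟩
  obtain ⟨w, hw⟩ := hF (algebraMap F _ x) (by rw [hx, map_mul])
  have := hw.card_lt_finrank h2 (by omega)
  rw [Module.finrank_self] at this
  omega

theorem stmt_13 (k : Type u) [Field k] (h2 : (2 : k) ≠ 0) (n : ℕ) (hn : 5 ≤ n)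
    (q : QuadraticForm k (Fin n → k)) (hq : NondegQF q) :
    ∀ (A : Type u) [Ring A] [Algebra k A] [Algebra.IsCentral k A] [IsSimpleRing A]
      [FiniteDimensional k A],
      SplitsIn k A (quadricFunctionField q) → IsSplitAlg k A := by
  intro A _ _ _ _ _ hsplit
  obtain ⟨m, rfl⟩ : ∃ m, n = m + 1 := ⟨n - 1, by omega⟩
  obtain ⟨N, hN, ⟨e⟩⟩ := hsplit
  have : IsArtinianRing A := IsArtinianRing.of_finite k A
  obtain ⟨r, hr, D, _, _, _, ⟨eA⟩⟩ := IsSimpleRing.exists_algEquiv_matrix_divisionRing_finite k A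
  obtain ⟨P, a, hP, ha, hdiag⟩ := exists_diagonalization.{u, u} h2 q hq
  obtain ⟨F, _, _, t, ht, hF⟩ := exists_generic_field k m (fun i => -(a i.succ / a 0))
    (fun i => neg_ne_zero.2 (div_ne_zero (ha _) (ha 0)))
  set δ := ∑ i : Fin m, algebraMap k F (-(a i.succ / a 0)) * t i ^ 2 with hδ
  have hempty : ∀ (E : Type u) [Ring E] [Algebra k E] (u : Fin 0 → E), IsAnticommFamily k u :=
    fun E _ _ u => ⟨fun i => i.elim0, fun i => i.elim0⟩
  have hsq : ¬ IsSquare δ := not_isSquare_generic h2 (m := m) (by omega) fun v hv =>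
    (hF k).2 0 Fin.elim0 v (hempty _ _) (fun i => i.elim0) hv
  have hirr : Irreducible (Polynomial.X ^ 2 - Polynomial.C δ) := irreducible_X_sq_sub_C hsq
  have : Fact (Irreducible (Polynomial.X ^ 2 - Polynomial.C δ)) := ⟨hirr⟩
  let L := AdjoinRoot (Polynomial.X ^ 2 - Polynomial.C δ)
  let s : L := AdjoinRoot.root _
  have hs : s * s = algebraMap F L δ := by
    have := AdjoinRoot.eval₂_root (Polynomial.X ^ 2 - Polynomial.C δ)
    simp only [Polynomial.eval₂_sub, Polynomial.eval₂_pow, Polynomial.eval₂_X, Polynomial.eval₂_C,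
      sub_eq_zero] at this
    rw [← sq]
    exact this
  have hFL : Module.finrank F L = 2 := by
    rw [(AdjoinRoot.powerBasis hirr.ne_zero).finrank, AdjoinRoot.powerBasis_dim,
      Polynomial.natDegree_X_pow_sub_C]
  obtain ⟨φ⟩ := nonempty_algHom_quadricFunctionField_of_diagonalization (L := L) ht q P hP a (ha 0)
    (fun y => hdiag L y) (fun y => hdiag _ y) hsq hs
  have : Nontrivial (quadricFunctionField q) := φ.toRingHom.domain_nontrivial
  let Φ : Matrix (Fin r) (Fin r) D →ₐ[k] Matrix (Fin N) (Fin N) L :=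
    φ.mapMatrix.comp ((e.toAlgHom.restrictScalars k).comp
      ((Algebra.TensorProduct.includeRight).comp eA.symm.toAlgHom))
  have hdimA : Module.finrank k A = r ^ 2 * Module.finrank k D := by
    rw [eA.toLinearEquiv.finrank_eq, Module.finrank_matrix]
    simp [sq]
  have hdim : N ^ 2 = r ^ 2 * Module.finrank k D := by
    rw [← hdimA, ← Module.finrank_baseChange (R := quadricFunctionField q),
      e.toLinearEquiv.finrank_eq, Module.finrank_matrix]
    simp [sq]
  have hD1 : Module.finrank k D = 1 := by
    by_contra hD1
    have := (hF D).1
    have : NeZero N := ⟨hN.ne'⟩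
    obtain ⟨hD4, x, hx⟩ := exists_sq_eq_of_splits hFL Φ hdim hD1 s δ hs
    obtain ⟨w, hw⟩ := (hF D).2 0 Fin.elim0 x (hempty _ _) (fun i => i.elim0) hx
    have := hw.card_lt_finrank h2 (by omega)
    omega
  have hbij : Function.Bijective (algebraMap k D) :=
    Module.Free.bijective_algebraMap_of_finrank_eq_one hD1
  exact ⟨r, Nat.pos_of_neZero r,
    ⟨eA.trans (AlgEquiv.ofBijective (Algebra.ofId k D) hbij).symm.mapMatrix⟩⟩

end
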